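/- Let N ≥ 1, p > 0, and suppose N < 2 + (4/(p+1))(p + √(p(p+1))). Let ω₁, ω₂ : ℝ^N → ℝ be smooth positive functions such that: ω₂ is bounded on ℝ^N; there is a constant C > 0 with ω₁(x) ≤ C ω₂(x) for all x with |x| sufficiently large; and ∇ω₁(x) · x ≤ 0 for all x with |x| sufficiently large. Then there is no positive stable super-solution of the equation −div(ω₁ ∇u) = −ω₂ u^{−p} in ℝ^N. -/

import Mathlib

open MeasureTheory Filter Real
open scoped RealInnerProductSpace

noncomputable def vdiv {N : ℕ} (V : EuclideanSpace ℝ (Fin N) → EuclideanSpace ℝ (Fin N))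
    (x : EuclideanSpace ℝ (Fin N)) : ℝ :=
  LinearMap.trace ℝ (EuclideanSpace ℝ (Fin N)) (fderiv ℝ V x).toLinearMap

def annulus (N : ℕ) (R : ℝ) : Set (EuclideanSpace ℝ (Fin N)) :=
  {x | R < ‖x‖ ∧ ‖x‖ < 2 * R}

lemma contDiff_gradient {E : Type*} [NormedAddCommGroup E] [InnerProductSpace ℝ E]
    [CompleteSpace E] {f : E → ℝ} {n m : WithTop ℕ∞} (hf : ContDiff ℝ n f) (h : m + 1 ≤ n) :
    ContDiff ℝ m (gradient f) :=
  (InnerProductSpace.toDual ℝ E).symm.contDiff.comp (hf.fderiv_right h)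

lemma gradient_rpow_mul {E : Type*} [NormedAddCommGroup E] [InnerProductSpace ℝ E]
    [CompleteSpace E] {u f : E → ℝ} {x : E} (s : ℝ) (hu : DifferentiableAt ℝ u x)
    (hux : 0 < u x) (hf : DifferentiableAt ℝ f x) :
    gradient (fun y => u y ^ s * f y) x =
      (u x ^ s) • gradient f x + (s * u x ^ (s - 1) * f x) • gradient u x := by
  apply HasGradientAt.gradient
  rw [hasGradientAt_iff_hasFDerivAt]
  refine ((hu.hasFDerivAt.rpow_const (p := s) (Or.inl hux.ne')).mul hf.hasFDerivAt).congr_fderiv ?_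
  simp only [map_add, map_smul, toDual_gradient, smul_smul]
  congr 2
  ring

lemma gradient_pow {E : Type*} [NormedAddCommGroup E] [InnerProductSpace ℝ E]
    [CompleteSpace E] {f : E → ℝ} {x : E} (n : ℕ) (hf : DifferentiableAt ℝ f x) :
    gradient (fun y => f y ^ n) x = (n * f x ^ (n - 1)) • gradient f x := by
  apply HasGradientAt.gradient
  rw [hasGradientAt_iff_hasFDerivAt]
  refine (hf.hasFDerivAt.pow n).congr_fderiv ?_
  simp only [map_smul, toDual_gradient]
  simp

lemma vdiv_smul {N : ℕ} {f : EuclideanSpace ℝ (Fin N) → ℝ}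
    {V : EuclideanSpace ℝ (Fin N) → EuclideanSpace ℝ (Fin N)} {x : EuclideanSpace ℝ (Fin N)}
    (hf : DifferentiableAt ℝ f x) (hV : DifferentiableAt ℝ V x) :
    vdiv (fun y => f y • V y) x = f x * vdiv V x + ⟪gradient f x, V x⟫ := by
  unfold vdiv
  rw [fderiv_fun_smul hf hV, inner_gradient_left, ContinuousLinearMap.toLinearMap_add, map_add]
  congr 1
  · simp
  · exact LinearMap.trace_smulRight _ _

lemma integral_fderiv_apply_eq_zero {E : Type*} [NormedAddCommGroup E] [NormedSpace ℝ E]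
    [FiniteDimensional ℝ E] [MeasurableSpace E] [BorelSpace E] (μ : Measure E)
    [μ.IsAddHaarMeasure] {g : E → ℝ} (hg : ContDiff ℝ 1 g) (hs : HasCompactSupport g) (v : E) :
    ∫ x, fderiv ℝ g x v ∂μ = 0 := by
  have hi : Integrable (fun x => fderiv ℝ g x v) μ :=
    ((hg.continuous_fderiv one_ne_zero).clm_apply continuous_const).integrable_of_hasCompactSupport
      (hs.fderiv_apply ℝ v)
  have := integral_mul_fderiv_eq_neg_fderiv_mul_of_integrable (μ := μ) (f := fun _ : E => (1 : ℝ))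
    (g := g) (v := v) (by simp) (by simpa using hi)
    (by simpa using hg.continuous.integrable_of_hasCompactSupport hs)
    (fun x _ => by fun_prop) (fun x _ => hg.differentiable one_ne_zero x)
  simpa using this

lemma vdiv_eq_sum {N : ℕ} {V : EuclideanSpace ℝ (Fin N) → EuclideanSpace ℝ (Fin N)}
    {x : EuclideanSpace ℝ (Fin N)} (hV : DifferentiableAt ℝ V x) :
    vdiv V x = ∑ i, fderiv ℝ (fun y => V y i) x (EuclideanSpace.single i 1) := by
  unfold vdiv
  rw [LinearMap.trace_eq_sum_inner _ (EuclideanSpace.basisFun (Fin N) ℝ)]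
  refine Finset.sum_congr rfl fun i _ => ?_
  have h := ((EuclideanSpace.proj i : EuclideanSpace ℝ (Fin N) →L[ℝ] ℝ).hasFDerivAt.comp x
    hV.hasFDerivAt).fderiv
  have h2 : (fun y => V y i) = (EuclideanSpace.proj i : EuclideanSpace ℝ (Fin N) →L[ℝ] ℝ) ∘ V := rfl
  rw [h2, h]
  simp [EuclideanSpace.inner_single_left]

lemma contDiff_coord {N : ℕ} {V : EuclideanSpace ℝ (Fin N) → EuclideanSpace ℝ (Fin N)}
    {n : WithTop ℕ∞} (hV : ContDiff ℝ n V) (i : Fin N) : ContDiff ℝ n (fun y => V y i) :=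
  (EuclideanSpace.proj i : EuclideanSpace ℝ (Fin N) →L[ℝ] ℝ).contDiff.comp hV

lemma hasCompactSupport_coord {N : ℕ}
    {V : EuclideanSpace ℝ (Fin N) → EuclideanSpace ℝ (Fin N)} (hs : HasCompactSupport V)
    (i : Fin N) : HasCompactSupport (fun y => V y i) :=
  hs.comp_left (g := fun z : EuclideanSpace ℝ (Fin N) => z i) rfl

lemma integrable_fderiv_coord {N : ℕ}
    {V : EuclideanSpace ℝ (Fin N) → EuclideanSpace ℝ (Fin N)}
    (hV : ContDiff ℝ 1 V) (hs : HasCompactSupport V) (i : Fin N) (v : EuclideanSpace ℝ (Fin N)) :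
    Integrable (fun x => fderiv ℝ (fun y => V y i) x v) :=
  (((contDiff_coord hV i).continuous_fderiv one_ne_zero).clm_apply
    continuous_const).integrable_of_hasCompactSupport ((hasCompactSupport_coord hs i).fderiv_apply ℝ _)

lemma integrable_vdiv {N : ℕ} {V : EuclideanSpace ℝ (Fin N) → EuclideanSpace ℝ (Fin N)}
    (hV : ContDiff ℝ 1 V) (hs : HasCompactSupport V) : Integrable (vdiv V) := by
  refine Integrable.congr ?_ (.of_forall fun x =>
    (vdiv_eq_sum (hV.differentiable one_ne_zero x)).symm)
  exact integrable_finsetSum _ fun i _ => integrable_fderiv_coord hV hs i _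

/-- The divergence theorem for compactly supported vector fields. -/
lemma integral_vdiv_eq_zero {N : ℕ} {V : EuclideanSpace ℝ (Fin N) → EuclideanSpace ℝ (Fin N)}
    (hV : ContDiff ℝ 1 V) (hs : HasCompactSupport V) : ∫ x, vdiv V x = 0 := by
  simp_rw [fun x => vdiv_eq_sum (hV.differentiable one_ne_zero x)]
  rw [integral_finsetSum _ fun i _ => integrable_fderiv_coord hV hs i _]
  exact Finset.sum_eq_zero fun i _ => integral_fderiv_apply_eq_zero volume (contDiff_coord hV i)
    (hasCompactSupport_coord hs i) _

lemma norm_sq_add_inner_le {E : Type*} [NormedAddCommGroup E] [InnerProductSpace ℝ E]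
    (v w : E) (s t l : ℝ) {k : ℝ} (hk : 0 < k) (hkl : k = l * (2 * t + 1) - t ^ 2) :
    ‖w - (t * s) • v‖ ^ 2 + l * ⟪(2 * s) • w - ((2 * t + 1) * s ^ 2) • v, v⟫ ≤
      (1 + (l - t) ^ 2 / k) * ‖w‖ ^ 2 := by
  have h : 0 ≤ k * ‖s • v - ((l - t) / k) • w‖ ^ 2 := by positivity
  rw [norm_sub_sq_real, norm_smul, norm_smul, mul_pow, mul_pow, real_inner_smul_left,
    real_inner_smul_right, real_inner_comm, norm_eq_abs, norm_eq_abs, sq_abs, sq_abs] at h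
  rw [norm_sub_sq_real, inner_sub_left, norm_smul, mul_pow, real_inner_smul_left,
    real_inner_smul_right, real_inner_smul_left, real_inner_self_eq_norm_sq, norm_eq_abs, sq_abs]
  have h2 : k * (s ^ 2 * ‖v‖ ^ 2 - 2 * (s * ((l - t) / k * ⟪w, v⟫)) + ((l - t) / k) ^ 2 * ‖w‖ ^ 2)
    = k * s ^ 2 * ‖v‖ ^ 2 - 2 * s * (l - t) * ⟪w, v⟫ + (l - t) ^ 2 / k * ‖w‖ ^ 2 := by
    field_simp
  rw [h2] at h
  nth_rewrite 1 [hkl] at h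
  linarith

lemma hasCompactSupport_gradient {E : Type*} [NormedAddCommGroup E] [InnerProductSpace ℝ E]
    [CompleteSpace E] {f : E → ℝ} (hf : HasCompactSupport f) : HasCompactSupport (gradient f) :=
  (hf.fderiv ℝ).comp_left (g := (InnerProductSpace.toDual ℝ E).symm) (map_zero _)

/-- The Caccioppoli-type inequality obtained by testing stability with `u ^ (-t) * φ` and the
differential inequality with `u ^ (-2 * t - 1) * φ ^ 2`. -/
lemma exists_stable_energy_bound {p t : ℝ} (ht : 0 < t) (hpt : t ^ 2 < p * (2 * t + 1)) :
    ∃ D : ℝ, 0 < D ∧ ∀ (N : ℕ) (ω₁ ω₂ u φ : EuclideanSpace ℝ (Fin N) → ℝ),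
      ContDiff ℝ 1 ω₁ → Continuous ω₂ → (∀ x, 0 < ω₁ x) → ContDiff ℝ 2 u → (∀ x, 0 < u x) →
      (∀ x, -(ω₂ x * u x ^ (-p)) ≤ -vdiv (fun y => ω₁ y • gradient u y) x) →
      (∀ ψ : EuclideanSpace ℝ (Fin N) → ℝ, ContDiff ℝ 2 ψ → HasCompactSupport ψ →
        ∫ x, p * ω₂ x * u x ^ (-p - 1) * ψ x ^ 2 ≤ ∫ x, ω₁ x * ‖gradient ψ x‖ ^ 2) →
      ContDiff ℝ 2 φ → HasCompactSupport φ →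
      ∫ x, ω₂ x * u x ^ (-p - 1) * (u x ^ (-t) * φ x) ^ 2 ≤
        ∫ x, D * (ω₁ x * (u x ^ (-t)) ^ 2 * ‖gradient φ x‖ ^ 2) := by
  obtain ⟨l, hl₁, hl₂⟩ := exists_between ((div_lt_iff₀ (by positivity : 0 < 2 * t + 1)).2 hpt)
  have hl₀ : 0 < l := lt_trans (by positivity) hl₁
  rw [div_lt_iff₀ (by positivity)] at hl₁
  obtain ⟨k, hk⟩ : ∃ k, k = l * (2 * t + 1) - t ^ 2 := ⟨_, rfl⟩
  have hk₀ : 0 < k := by linarith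
  have hpl : 0 < p - l := by linarith
  refine ⟨(1 + (l - t) ^ 2 / k) / (p - l), by positivity, ?_⟩
  intro N ω₁ ω₂ u φ hω₁ hω₂ hω₁pos hu hupos hsuper hstab hφ hφs
  have hrpow : ∀ s : ℝ, ContDiff ℝ 2 (fun x => u x ^ s) := fun s =>
    hu.rpow_const_of_ne fun x => (hupos x).ne'
  have hgφ : ContDiff ℝ 1 (gradient φ) := contDiff_gradient hφ (by norm_num)
  have hV : ContDiff ℝ 1 (fun y => ω₁ y • gradient u y) :=
    hω₁.smul (contDiff_gradient hu (by norm_num))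
  have hψ : ContDiff ℝ 2 (fun x => u x ^ (-t) * φ x) := (hrpow _).mul hφ
  have hψs : HasCompactSupport (fun x => u x ^ (-t) * φ x) := hφs.mul_left
  have hζ : ContDiff ℝ 2 (fun x => u x ^ (-2 * t - 1) * φ x ^ 2) := (hrpow _).mul (hφ.pow 2)
  have hφs2 : HasCompactSupport (fun x => φ x ^ 2) :=
    hφs.comp_left (g := fun z : ℝ => z ^ 2) (by simp)
  have hζs : HasCompactSupport (fun x => u x ^ (-2 * t - 1) * φ x ^ 2) := hφs2.mul_left
  have hW : ContDiff ℝ 1 (fun y => (u y ^ (-2 * t - 1) * φ y ^ 2) • (ω₁ y • gradient u y)) :=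
    (hζ.of_le (by norm_num)).smul hV
  have hWs : HasCompactSupport
      (fun y => (u y ^ (-2 * t - 1) * φ y ^ 2) • (ω₁ y • gradient u y)) := hζs.smul_right
  have hGi : Integrable (fun x => ω₁ x * (u x ^ (-t)) ^ 2 * ‖gradient φ x‖ ^ 2) := by
    refine Continuous.integrable_of_hasCompactSupport ?_ ?_
    · exact (hω₁.continuous.mul ((hrpow _).continuous.pow 2)).mul (hgφ.continuous.norm.pow 2)
    · exact HasCompactSupport.mul_left
        ((hasCompactSupport_gradient hφs).comp_left (g := fun z => ‖z‖ ^ 2) (by simp))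
  have hAi : Integrable (fun x => ω₂ x * u x ^ (-p - 1) * (u x ^ (-t) * φ x) ^ 2) := by
    refine Continuous.integrable_of_hasCompactSupport ?_ ?_
    · exact (hω₂.mul (hrpow _).continuous).mul (hψ.continuous.pow 2)
    · exact HasCompactSupport.mul_left (hψs.comp_left (g := fun z : ℝ => z ^ 2) (by simp))
  have hBi : Integrable (fun x => ω₁ x * ‖gradient (fun x => u x ^ (-t) * φ x) x‖ ^ 2) := by
    refine Continuous.integrable_of_hasCompactSupport ?_ ?_
    · exact hω₁.continuous.mul
        ((contDiff_gradient (m := 1) hψ (by norm_num)).continuous.norm.pow 2)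
    · exact HasCompactSupport.mul_left
        ((hasCompactSupport_gradient hψs).comp_left (g := fun z => ‖z‖ ^ 2) (by simp))
  have hpoint : ∀ x, ω₁ x * ‖gradient (fun x => u x ^ (-t) * φ x) x‖ ^ 2 +
      l * vdiv (fun y => (u y ^ (-2 * t - 1) * φ y ^ 2) • (ω₁ y • gradient u y)) x ≤
      l * (ω₂ x * u x ^ (-p - 1) * (u x ^ (-t) * φ x) ^ 2) +
      (1 + (l - t) ^ 2 / k) * (ω₁ x * (u x ^ (-t)) ^ 2 * ‖gradient φ x‖ ^ 2) := by
    intro x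
    have hux := hupos x
    have hud := hu.differentiable two_ne_zero x
    have hφd := hφ.differentiable two_ne_zero x
    have hφ2d : DifferentiableAt ℝ (fun y => φ y ^ 2) x := hφd.pow 2
    rw [vdiv_smul (hζ.differentiable two_ne_zero x) (hV.differentiable one_ne_zero x),
      gradient_rpow_mul _ hud hux hφd, gradient_rpow_mul _ hud hux hφ2d, gradient_pow 2 hφd]
    set P := u x ^ (-t) with hP
    have e₁ : u x ^ (-t - 1) = P / u x := by rw [rpow_sub_one hux.ne']
    have e₂ : u x ^ (-2 * t) = P ^ 2 := by
      rw [hP, ← rpow_natCast, ← rpow_mul hux.le]; congr 1; push_cast; ring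
    have e₃ : u x ^ (-2 * t - 1) = P ^ 2 / u x := by rw [rpow_sub_one hux.ne', e₂]
    have e₄ : u x ^ (-2 * t - 1 - 1) = P ^ 2 / u x / u x := by rw [rpow_sub_one hux.ne', e₃]
    have e₅ : u x ^ (-p - 1) = u x ^ (-p) / u x := by rw [rpow_sub_one hux.ne']
    rw [e₁, e₄, e₃, e₅]
    have h₁ : P ^ 2 / u x * φ x ^ 2 * vdiv (fun y => ω₁ y • gradient u y) x ≤
        ω₂ x * (u x ^ (-p) / u x) * (P * φ x) ^ 2 := by
      calc _ ≤ P ^ 2 / u x * φ x ^ 2 * (ω₂ x * u x ^ (-p)) :=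
            mul_le_mul_of_nonneg_left (neg_le_neg_iff.1 (hsuper x)) (by positivity)
        _ = _ := by ring
    have h₂ := mul_le_mul_of_nonneg_left
      (norm_sq_add_inner_le (gradient u x) (gradient φ x) (φ x / u x) t l hk₀ hk)
      (mul_nonneg (hω₁pos x).le (sq_nonneg P))
    have h₃ : P • gradient φ x + (-t * (P / u x) * φ x) • gradient u x =
        P • (gradient φ x - (t * (φ x / u x)) • gradient u x) := by
      module
    have h₄ : (P ^ 2 / u x) • ((2 : ℕ) * φ x ^ (2 - 1)) • gradient φ x +
        ((-2 * t - 1) * (P ^ 2 / u x / u x) * φ x ^ 2) • gradient u x =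
        P ^ 2 • ((2 * (φ x / u x)) • gradient φ x -
          ((2 * t + 1) * (φ x / u x) ^ 2) • gradient u x) := by
      push_cast
      rw [pow_one]
      match_scalars <;> field_simp
      ring
    rw [h₃, h₄, norm_smul, mul_pow, norm_eq_abs, sq_abs, real_inner_smul_left,
      real_inner_smul_right]
    have h₅ := mul_le_mul_of_nonneg_left h₁ hl₀.le
    linarith
  have hint := integral_mono (hBi.add ((integrable_vdiv hW hWs).const_mul l))
    ((hAi.const_mul l).add (hGi.const_mul (1 + (l - t) ^ 2 / k))) hpoint
  rw [integral_add' hBi ((integrable_vdiv hW hWs).const_mul l),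
    integral_add' (hAi.const_mul l) (hGi.const_mul _), integral_const_mul, integral_const_mul,
    integral_const_mul, integral_vdiv_eq_zero hW hWs] at hint
  have hst := hstab _ hψ hψs
  simp_rw [mul_assoc p] at hst
  rw [integral_const_mul] at hst
  rw [integral_const_mul, div_mul_eq_mul_div, le_div_iff₀ hpl]
  linarith

lemma exists_cutoff (E : Type*) [NormedAddCommGroup E] [InnerProductSpace ℝ E]
    [FiniteDimensional ℝ E] :
    ∃ K : ℝ, ∀ R : ℝ, 0 < R → ∃ η : E → ℝ, ContDiff ℝ 2 η ∧ HasCompactSupport η ∧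
      (∀ x, 0 ≤ η x) ∧ (∀ x, η x ≤ 1) ∧ (∀ x, ‖x‖ ≤ R → η x = 1) ∧
      (∀ x, gradient η x ≠ 0 → R ≤ ‖x‖ ∧ ‖x‖ ≤ 2 * R) ∧ ∀ x, ‖gradient η x‖ ≤ K / R := by
  let f : ContDiffBump (0 : E) := ⟨1, 2, one_pos, one_lt_two⟩
  have hf : ContDiff ℝ 2 f := f.contDiff
  obtain ⟨K, hK⟩ := (hf.continuous_fderiv two_ne_zero).bounded_above_of_compact_support
    (f.hasCompactSupport.fderiv ℝ)
  have hnorm : ∀ (g : E → ℝ) x, ‖gradient g x‖ = ‖fderiv ℝ g x‖ := fun g x => by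
    rw [← toDual_gradient, LinearIsometryEquiv.norm_map]
  refine ⟨K, fun R hR => ⟨fun x => f (R⁻¹ • x), ?_, ?_, fun x => f.nonneg, fun x => f.le_one,
    ?_, ?_, ?_⟩⟩
  · exact hf.comp (contDiff_const_smul _)
  · exact f.hasCompactSupport.comp_homeomorph (Homeomorph.smulOfNeZero R⁻¹ (inv_ne_zero hR.ne'))
  · intro x hx
    apply f.one_of_mem_closedBall
    rw [mem_closedBall_zero_iff, norm_smul, norm_inv, norm_eq_abs, abs_of_pos hR,
      inv_mul_le_iff₀ hR]
    simpa [f] using hx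
  · intro x hx
    have hx' : fderiv ℝ f (R⁻¹ • x) ≠ 0 := by
      intro h
      apply hx
      rw [← norm_eq_zero, hnorm, fderiv_comp_smul, h, smul_zero, norm_zero]
    have hn : ‖R⁻¹ • x‖ = R⁻¹ * ‖x‖ := by
      rw [norm_smul, norm_inv, norm_eq_abs, abs_of_pos hR]
    constructor
    · by_contra! h
      apply hx'
      have : R⁻¹ • x ∈ Metric.ball (0 : E) f.rIn := by
        rw [mem_ball_zero_iff, hn, inv_mul_lt_iff₀ hR]
        simpa [f] using h
      rw [(f.eventuallyEq_one_of_mem_ball this).fderiv_eq]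
      exact fderiv_const_apply 1
    · have := support_fderiv_subset ℝ hx'
      rw [f.tsupport_eq, mem_closedBall_zero_iff, hn, inv_mul_le_iff₀ hR] at this
      simpa [f, mul_comm] using this
  · intro x
    rw [hnorm, fderiv_comp_smul, norm_smul, norm_inv, norm_eq_abs, abs_of_pos hR, div_eq_inv_mul]
    exact mul_le_mul_of_nonneg_left (hK _) (by positivity)

lemma mul_le_half_rpow_add_rpow {a b q r : ℝ} (ha : 0 ≤ a) (hb : 0 ≤ b)
    (hqr : q.HolderConjugate r) : a * b ≤ 1 / 2 * a ^ q + (2 * b) ^ r := by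
  have h := young_inequality_of_nonneg (a := 1 / 2 * a) (b := 2 * b) (by positivity)
    (by positivity) hqr
  rw [mul_rpow (by positivity) ha] at h
  have h₁ : (1 / 2 : ℝ) ^ q ≤ 1 / 2 := by
    simpa using rpow_le_rpow_of_exponent_ge (by norm_num : (0 : ℝ) < 1 / 2) (by norm_num) hqr.lt.le
  have h₂ : (1 / 2) ^ q * a ^ q / q ≤ (1 / 2) ^ q * a ^ q :=
    div_le_self (by positivity) hqr.lt.le
  have h₃ : (2 * b) ^ r / r ≤ (2 * b) ^ r := div_le_self (by positivity) hqr.symm.lt.le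
  have h₄ := mul_le_mul_of_nonneg_right h₁ (rpow_nonneg ha q)
  linarith

/-- In the subcritical dimension range there is an admissible exponent for the energy bound. -/
lemma exists_exponent_of_lt {p d : ℝ} (hp : 0 < p)
    (hd : d < 2 + 4 / (p + 1) * (p + √(p * (p + 1)))) :
    ∃ t : ℝ, 0 < t ∧ t ^ 2 < p * (2 * t + 1) ∧ d < 2 * ((p + 1 + 2 * t) / (p + 1)) := by
  have hs : 0 < √(p * (p + 1)) := by positivity
  have hsq : √(p * (p + 1)) ^ 2 = p * (p + 1) := sq_sqrt (by positivity)
  have hlt : max p ((d - 2) * (p + 1) / 4) < p + √(p * (p + 1)) := by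
    refine max_lt (by linarith) ?_
    rw [div_lt_iff₀ (by norm_num)]
    have : d - 2 < 4 * (p + √(p * (p + 1))) / (p + 1) := by
      rw [mul_div_right_comm]; linarith
    rw [lt_div_iff₀ (by positivity)] at this
    linarith
  obtain ⟨t, ht₁, ht₂⟩ := exists_between hlt
  obtain ⟨hpt, hdt⟩ := max_lt_iff.1 ht₁
  refine ⟨t, hp.trans hpt, ?_, ?_⟩
  · nlinarith [mul_self_lt_mul_self (sub_pos.2 hpt).le (show t - p < √(p * (p + 1)) by linarith)]
  · rw [mul_div_assoc', lt_div_iff₀ (by positivity)]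
    linarith

/-- Absorption of the gradient term of the energy bound by Young's inequality. -/
lemma mul_pow_le_half_add_rpow {p t U e b : ℝ} (hp : 0 < p) (ht : 0 < t) (hU : 0 < U)
    (he₀ : 0 ≤ e) (he₁ : e ≤ 1) (hb : 0 ≤ b) {n : ℕ} (hn : 1 / ((p + 1) / (2 * t)) ≤ n) :
    (U ^ (-t)) ^ 2 * e ^ (2 * n) * b ≤
      1 / 2 * (U ^ (-p - 1) * (U ^ (-t) * e ^ (n + 1)) ^ 2) +
        (2 * b) ^ ((p + 1 + 2 * t) / (p + 1)) := by
  have hqr : ((p + 1 + 2 * t) / (2 * t)).HolderConjugate ((p + 1 + 2 * t) / (p + 1)) := by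
    rw [holderConjugate_iff]
    constructor
    · rw [lt_div_iff₀ (by positivity)]; linarith
    · field_simp
      ring
  refine (mul_le_half_rpow_add_rpow (by positivity) hb hqr).trans ?_
  have h₁ : ((U ^ (-t)) ^ 2) ^ ((p + 1 + 2 * t) / (2 * t)) = U ^ (-p - 1) * (U ^ (-t)) ^ 2 := by
    rw [← rpow_natCast, ← rpow_mul hU.le, ← rpow_mul hU.le, ← rpow_add hU]
    congr 1
    field_simp
    push_cast
    ring
  have h₂ : (e ^ (2 * n)) ^ ((p + 1 + 2 * t) / (2 * t)) ≤ (e ^ (n + 1)) ^ 2 := by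
    rw [← pow_mul, ← rpow_natCast, ← rpow_mul he₀, ← rpow_natCast]
    refine rpow_le_rpow_of_exponent_ge_of_imp he₀ he₁ ?_ fun _ h => ?_
    · rw [div_le_iff₀ (by positivity)] at hn
      push_cast
      have : (p + 1 + 2 * t) / (2 * t) = (p + 1) / (2 * t) + 1 := by field_simp
      rw [this]
      linarith
    · exfalso
      have : (0 : ℝ) < n := lt_of_lt_of_le (by positivity) hn
      have : 0 < ((2 * n : ℕ) : ℝ) * ((p + 1 + 2 * t) / (2 * t)) := by push_cast; positivity
      linarith
  rw [mul_rpow (by positivity) (by positivity), h₁]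
  have h₃ := mul_le_mul_of_nonneg_left h₂
    (by positivity : 0 ≤ U ^ (-p - 1) * (U ^ (-t)) ^ 2)
  rw [mul_pow]
  linarith

theorem stmt_11 (N : ℕ) (hN : 1 ≤ N) (p : ℝ) (hp : 0 < p)
    (hdim : (N : ℝ) < 2 + 4/(p + 1) * (p + Real.sqrt (p * (p + 1))))
    (ω₁ ω₂ : EuclideanSpace ℝ (Fin N) → ℝ)
    (hω₁ : ContDiff ℝ (⊤ : ℕ∞) ω₁) (hω₂ : ContDiff ℝ (⊤ : ℕ∞) ω₂)
    (hω₁pos : ∀ x, 0 < ω₁ x) (hω₂pos : ∀ x, 0 < ω₂ x)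
    (hbdd : ∃ M : ℝ, ∀ x, ω₂ x ≤ M)
    (hcomp : ∃ C : ℝ, 0 < C ∧ ∃ R₀ : ℝ, ∀ x : EuclideanSpace ℝ (Fin N), R₀ ≤ ‖x‖ → ω₁ x ≤ C * ω₂ x)
    (hmono : ∃ R₀ : ℝ, ∀ x : EuclideanSpace ℝ (Fin N), R₀ ≤ ‖x‖ → ⟪gradient ω₁ x, x⟫ ≤ 0) :
    ¬ ∃ u : EuclideanSpace ℝ (Fin N) → ℝ, ContDiff ℝ 2 u ∧ (∀ x, 0 < u x) ∧
      (∀ x, -(ω₂ x * u x ^ (-p)) ≤ -vdiv (fun y => ω₁ y • gradient u y) x) ∧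
      (∀ ψ : EuclideanSpace ℝ (Fin N) → ℝ, ContDiff ℝ 2 ψ → HasCompactSupport ψ →
        ∫ x, p * ω₂ x * u x ^ (-p - 1) * ψ x ^ 2 ≤ ∫ x, ω₁ x * ‖gradient ψ x‖ ^ 2) := by
  
  rintro ⟨u, hu, hupos, hsuper, hstab⟩
  obtain ⟨M, hM⟩ := hbdd
  obtain ⟨C, hC, R₀, hCR⟩ := hcomp
  obtain ⟨t, ht, hpt, hNt⟩ := exists_exponent_of_lt hp hdim
  obtain ⟨D, hD, henergy⟩ := exists_stable_energy_bound ht hpt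
  obtain ⟨K, hK⟩ := exists_cutoff (EuclideanSpace ℝ (Fin N))
  obtain ⟨n, hn⟩ := exists_nat_ge (1 / ((p + 1) / (2 * t)))
  set r := (p + 1 + 2 * t) / (p + 1) with hr
  have hr₀ : 0 < r := by positivity
  have hM₀ : 0 ≤ M := (hω₂pos 0).le.trans (hM 0)
  have hrpow : ∀ s : ℝ, ContDiff ℝ 2 (fun x => u x ^ s) := fun s =>
    hu.rpow_const_of_ne fun x => (hupos x).ne'
  have hwc : Continuous (fun x => ω₂ x * u x ^ (-p - 1) * (u x ^ (-t)) ^ 2) :=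
    (hω₂.continuous.mul (hrpow _).continuous).mul ((hrpow _).continuous.pow 2)
  obtain ⟨x₀, -, hx₀⟩ := (isCompact_closedBall (0 : EuclideanSpace ℝ (Fin N)) 1).exists_isMinOn
    (Metric.nonempty_closedBall.2 zero_le_one) hwc.continuousOn
  set δ := ω₂ x₀ * u x₀ ^ (-p - 1) * (u x₀ ^ (-t)) ^ 2 with hδ
  have hδ₀ : 0 < δ := by
    have h₁ := hω₂pos x₀
    have h₂ := hupos x₀
    positivity
  set B := 2 * (D * C * (n + 1) ^ 2 * K ^ 2) with hB
  have hB₀ : 0 ≤ B := by positivity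
  set v := volume.real (Metric.ball (0 : EuclideanSpace ℝ (Fin N)) 1) with hv
  have hv₀ : 0 < v := ENNReal.toReal_pos (Metric.measure_ball_pos _ _ one_pos).ne'
    measure_ball_lt_top.ne
  have hvol : ∀ R : ℝ, 0 ≤ R →
      volume.real (Metric.closedBall (0 : EuclideanSpace ℝ (Fin N)) R) = R ^ N * v := by
    intro R hR
    rw [Measure.addHaar_real_closedBall _ _ hR, finrank_euclideanSpace_fin]
  have hkey : ∀ R : ℝ, max 1 R₀ ≤ R → δ * v ≤ 2 * M * B ^ r * 2 ^ N * v * R ^ (-(2 * r - N)) := by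
    intro R hR
    obtain ⟨hR₁, hR₀⟩ := max_le_iff.1 hR
    have hRpos : 0 < R := one_pos.trans_le hR₁
    obtain ⟨η, hη, hηs, hη₀, hη₁, hηR, hηg, hηK⟩ := hK R hRpos
    have hφ : ContDiff ℝ 2 (fun x => η x ^ (n + 1)) := hη.pow _
    have hφs : HasCompactSupport (fun x => η x ^ (n + 1)) :=
      hηs.comp_left (g := fun z : ℝ => z ^ (n + 1)) (by simp)
    have hen := henergy N ω₁ ω₂ u _ (hω₁.of_le (by exact_mod_cast le_top)) hω₂.continuous hω₁pos hu
      hupos hsuper hstab hφ hφs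
    have hAi : Integrable (fun x => ω₂ x * u x ^ (-p - 1) * (u x ^ (-t) * η x ^ (n + 1)) ^ 2) := by
      refine Continuous.integrable_of_hasCompactSupport ?_ ?_
      · exact (hω₂.continuous.mul (hrpow _).continuous).mul
          (((hrpow _).mul hφ).continuous.pow 2)
      · exact HasCompactSupport.mul_left
          ((hφs.mul_left (f := fun x => u x ^ (-t))).comp_left (g := fun z : ℝ => z ^ 2) (by simp))
    have hGi : Integrable (fun x => D * (ω₁ x * (u x ^ (-t)) ^ 2 *
        ‖gradient (fun x => η x ^ (n + 1)) x‖ ^ 2)) := by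
      refine (Continuous.integrable_of_hasCompactSupport ?_ ?_).const_mul D
      · exact (hω₁.continuous.mul ((hrpow _).continuous.pow 2)).mul
          ((contDiff_gradient (m := 1) hφ (by norm_num)).continuous.norm.pow 2)
      · exact HasCompactSupport.mul_left
          ((hasCompactSupport_gradient hφs).comp_left (g := fun z => ‖z‖ ^ 2) (by simp))
    have hindi : ∀ ρ c : ℝ, Integrable
        ((Metric.closedBall (0 : EuclideanSpace ℝ (Fin N)) ρ).indicator fun _ => c) := fun ρ c =>
      (integrable_indicator_iff measurableSet_closedBall).2
        (integrableOn_const measure_closedBall_lt_top.ne)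
    have hpoint : ∀ x, D * (ω₁ x * (u x ^ (-t)) ^ 2 * ‖gradient (fun x => η x ^ (n + 1)) x‖ ^ 2) ≤
        1 / 2 * (ω₂ x * u x ^ (-p - 1) * (u x ^ (-t) * η x ^ (n + 1)) ^ 2) +
        (Metric.closedBall (0 : EuclideanSpace ℝ (Fin N)) (2 * R)).indicator
          (fun _ => M * (B / R ^ 2) ^ r) x := by
      intro x
      have h₁ := hω₂pos x
      have h₂ := hupos x
      have hind₀ : 0 ≤ (Metric.closedBall (0 : EuclideanSpace ℝ (Fin N)) (2 * R)).indicator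
          (fun _ => M * (B / R ^ 2) ^ r) x :=
        Set.indicator_nonneg (fun _ _ => by positivity) x
      rw [gradient_pow _ (hη.differentiable two_ne_zero x)]
      by_cases hg : gradient η x = 0
      · rw [hg, smul_zero, norm_zero, zero_pow two_ne_zero, mul_zero, mul_zero]
        positivity
      obtain ⟨hxR, hx2R⟩ := hηg x hg
      rw [Set.indicator_of_mem (mem_closedBall_zero_iff.2 hx2R)]
      set b := D * C * (n + 1) ^ 2 * ‖gradient η x‖ ^ 2 with hb
      have hb₀ : 0 ≤ b := by positivity
      have hbB : 2 * b ≤ B / R ^ 2 := by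
        have := pow_le_pow_left₀ (norm_nonneg _) (hηK x) 2
        calc 2 * b ≤ 2 * (D * C * (n + 1) ^ 2 * (K / R) ^ 2) := by rw [hb]; gcongr
          _ = B / R ^ 2 := by rw [hB]; ring
      have hyoung := mul_pow_le_half_add_rpow hp ht h₂ (hη₀ x) (hη₁ x) hb₀ hn
      calc _ = D * (n + 1) ^ 2 * ‖gradient η x‖ ^ 2 * (u x ^ (-t)) ^ 2 * η x ^ (2 * n) * ω₁ x := by
            rw [norm_smul, mul_pow, norm_eq_abs, sq_abs]
            push_cast
            ring
        _ ≤ D * (n + 1) ^ 2 * ‖gradient η x‖ ^ 2 * (u x ^ (-t)) ^ 2 * η x ^ (2 * n) *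
              (C * ω₂ x) := by
            have := hη₀ x
            exact mul_le_mul_of_nonneg_left (hCR x (hR₀.trans hxR)) (by positivity)
        _ = ω₂ x * ((u x ^ (-t)) ^ 2 * η x ^ (2 * n) * b) := by rw [hb]; ring
        _ ≤ ω₂ x * (1 / 2 * (u x ^ (-p - 1) * (u x ^ (-t) * η x ^ (n + 1)) ^ 2) + (2 * b) ^ r) :=
            mul_le_mul_of_nonneg_left hyoung h₁.le
        _ = 1 / 2 * (ω₂ x * u x ^ (-p - 1) * (u x ^ (-t) * η x ^ (n + 1)) ^ 2) +
              ω₂ x * (2 * b) ^ r := by ring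
        _ ≤ _ := by
            gcongr
            exact hM x
    have hupper := hen.trans (integral_mono hGi
      ((hAi.const_mul (1 / 2)).add (hindi (2 * R) (M * (B / R ^ 2) ^ r))) hpoint)
    rw [integral_add' (hAi.const_mul _) (hindi _ _), integral_const_mul,
      integral_indicator_const _ measurableSet_closedBall, hvol _ (by positivity),
      smul_eq_mul] at hupper
    have hlower := integral_mono (hindi 1 δ) hAi (fun x => by
      have h₁ := hω₂pos x
      have h₂ := hupos x
      refine Set.indicator_apply_le' (fun hx => ?_) (fun _ => by positivity)
      have hx1 := mem_closedBall_zero_iff.1 hx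
      simp only [hηR x (hx1.trans hR₁), one_pow, mul_one]
      exact hx₀ hx)
    rw [integral_indicator_const _ measurableSet_closedBall, hvol _ zero_le_one, one_pow, one_mul,
      smul_eq_mul] at hlower
    have hpow : (B / R ^ 2) ^ r * R ^ N = B ^ r * R ^ (-(2 * r - N)) := by
      rw [div_rpow hB₀ (by positivity), ← rpow_natCast R 2, ← rpow_natCast R N,
        ← rpow_mul hRpos.le, neg_sub, rpow_sub hRpos]
      push_cast
      ring
    calc δ * v ≤ 2 * ((2 * R) ^ N * v * (M * (B / R ^ 2) ^ r)) := by linarith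
      _ = 2 * M * 2 ^ N * v * ((B / R ^ 2) ^ r * R ^ N) := by rw [mul_pow]; ring
      _ = _ := by rw [hpow]; ring
  have hlim := (tendsto_rpow_neg_atTop (sub_pos.2 hNt)).const_mul (2 * M * B ^ r * 2 ^ N * v)
  rw [mul_zero] at hlim
  exact (mul_pos hδ₀ hv₀).not_ge
    (ge_of_tendsto hlim (eventually_atTop.2 ⟨max 1 R₀, hkey⟩))
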